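/- arXiv:1404.0860 — 2 statements merged into one kernel-verified Lean document; each statement's English description precedes it below -/
import Mathlib

section
/- Let x be a p-variate random vector and y a q-variate random vector, let z = (xᵀ, yᵀ)ᵀ, and let V be a scatter functional on ℝ^{p+q} that is well defined at z, partitioned as V(z) = [[V_xx, V_xy],[V_yx, V_yy]] with V_xx the p×p upper-left block, and suppose V_xx is nonsingular. Define B(y, x) = V_xx^{-1} V_xy. Then B is regression equivariant: for every p×q real matrix C, B(y + Cᵀx, x) = B(y, x) + C (where B(y + Cᵀx, x) is computed from V applied to (xᵀ, (y + Cᵀx)ᵀ)ᵀ). -/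
open MeasureTheory ProbabilityTheory Matrix

/-- A scatter functional on `ℝ^n` (coordinates indexed by `n`): a matrix-valued
functional of distributions (measures) on `n → ℝ`, defined on a domain `dom`,
whose values are symmetric positive semi-definite matrices, and which is
affine equivariant whenever both sides are defined. -/
structure ScatterFunctional (n : Type*) [Fintype n] [DecidableEq n] where
  dom : Measure (n → ℝ) → Prop
  V : Measure (n → ℝ) → Matrix n n ℝ
  symm : ∀ μ, dom μ → (V μ).IsSymm
  posSemidef : ∀ μ, dom μ → (V μ).PosSemidef
  equivariant : ∀ (μ : Measure (n → ℝ)) (A : Matrix n n ℝ) (b : n → ℝ),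
    IsUnit A.det → dom μ → dom (μ.map (fun x => A.mulVec x + b)) →
    V (μ.map (fun x => A.mulVec x + b)) = A * V μ * Aᵀ

/-- `J` is a sign-change matrix: a diagonal matrix with `±1` diagonal entries. -/
def IsSignChangeMatrix {n : Type*} [Fintype n] [DecidableEq n]
    (J : Matrix n n ℝ) : Prop :=
  ∃ s : n → ℝ, (∀ i, s i = 1 ∨ s i = -1) ∧ J = Matrix.diagonal s

/-- `P` is a permutation matrix. -/
def IsPermutationMatrix {n : Type*} [Fintype n] [DecidableEq n]
    (P : Matrix n n ℝ) : Prop :=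
  ∃ σ : Equiv.Perm n, P = σ.permMatrix ℝ

/-- A distribution `μ` on `ℝ^p` is exchangeable sign-symmetric about the origin:
`P * J * y ∼ y` for every permutation matrix `P` and sign-change matrix `J`. -/
def ExchangeableSignSymmetric {p : ℕ} (μ : Measure (Fin p → ℝ)) : Prop :=
  ∀ P J : Matrix (Fin p) (Fin p) ℝ, IsPermutationMatrix P → IsSignChangeMatrix J →
    μ.map (fun y => (P * J).mulVec y) = μ


/-- The (observational regression) slope functional `B(y,x) = V_xx⁻¹ V_xy`
computed from a scatter matrix of the concatenated vector `z = (xᵀ, yᵀ)ᵀ`,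
whose coordinates are indexed by `Fin p ⊕ Fin q`. -/
noncomputable def slopeB {p q : ℕ}
    (M : Matrix (Fin p ⊕ Fin q) (Fin p ⊕ Fin q) ℝ) : Matrix (Fin p) (Fin q) ℝ :=
  M.toBlocks₁₁⁻¹ * M.toBlocks₁₂

theorem stmt6 {p q : ℕ} (V : ScatterFunctional (Fin p ⊕ Fin q))
    {Ω : Type*} [MeasurableSpace Ω] (Pr : Measure Ω) [IsProbabilityMeasure Pr]
    (x : Ω → Fin p → ℝ) (y : Ω → Fin q → ℝ)
    (hx : Measurable x) (hy : Measurable y)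
    (z : Ω → (Fin p ⊕ Fin q) → ℝ) (hz : z = fun ω => Sum.elim (x ω) (y ω))
    (hdom : V.dom (Pr.map z))
    (hxx : IsUnit (V.V (Pr.map z)).toBlocks₁₁.det)
    (C : Matrix (Fin p) (Fin q) ℝ)
    (z' : Ω → (Fin p ⊕ Fin q) → ℝ)
    (hz' : z' = fun ω => Sum.elim (x ω) (y ω + Cᵀ.mulVec (x ω)))
    (hdom' : V.dom (Pr.map z')) :
    slopeB (V.V (Pr.map z')) = slopeB (V.V (Pr.map z)) + C := by
  subst hz
  subst hz'
  have hmz : Measurable (fun ω => (Sum.elim (x ω) (y ω) : (Fin p ⊕ Fin q) → ℝ)) := by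
    rw [measurable_pi_iff]
    rintro (i | i)
    · exact (measurable_pi_apply i).comp hx
    · exact (measurable_pi_apply i).comp hy
  let A : Matrix (Fin p ⊕ Fin q) (Fin p ⊕ Fin q) ℝ := Matrix.fromBlocks 1 0 Cᵀ 1
  have hA : IsUnit A.det := by
    simp [A]
  have hmA : Measurable (fun v : (Fin p ⊕ Fin q) → ℝ => A.mulVec v + 0) := by
    apply Continuous.measurable
    fun_prop
  have hmap : Pr.map (fun ω => (Sum.elim (x ω) (y ω + Cᵀ.mulVec (x ω)) : (Fin p ⊕ Fin q) → ℝ))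
      = (Pr.map (fun ω => (Sum.elim (x ω) (y ω) : (Fin p ⊕ Fin q) → ℝ))).map
        (fun v => A.mulVec v + 0) := by
    rw [Measure.map_map hmA hmz]
    congr 1
    funext ω
    simp [A, Matrix.fromBlocks_mulVec, Function.comp_def, add_comm]
  rw [hmap] at hdom' ⊢
  rw [V.equivariant _ A 0 hA hdom hdom']
  generalize V.V (Pr.map (fun ω => (Sum.elim (x ω) (y ω) : (Fin p ⊕ Fin q) → ℝ))) = M at hxx ⊢
  have hM := Matrix.fromBlocks_toBlocks M
  have key : A * M * Aᵀ = Matrix.fromBlocks M.toBlocks₁₁ (M.toBlocks₁₁ * C + M.toBlocks₁₂)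
      (Cᵀ * M.toBlocks₁₁ + M.toBlocks₂₁)
      ((Cᵀ * M.toBlocks₁₁ + M.toBlocks₂₁) * C + (Cᵀ * M.toBlocks₁₂ + M.toBlocks₂₂)) := by
    conv_lhs => rw [← hM]
    simp [A, Matrix.fromBlocks_multiply, Matrix.fromBlocks_transpose]
  rw [key]
  simp only [slopeB, Matrix.toBlocks_fromBlocks₁₁, Matrix.toBlocks_fromBlocks₁₂]
  rw [Matrix.mul_add, Matrix.nonsing_inv_mul_cancel_left _ _ hxx, add_comm]
end

section
/- Let x be a p-variate random vector with finite fourth moments and nonsingular covariance matrix cov(x), and let w and v be independent random vectors each distributed as x. Then (1/2) E[ ((w − v)ᵀ cov(x)^{-1} (w − v)) (w − v)(w − v)ᵀ ] = wcov_2(x) + (p + 2) cov(x); equivalently, the kurtosis matrix satisfies wcov_2(x) = (1/2) E[ ((w − v)ᵀ cov(x)^{-1} (w − v)) (w − v)(w − v)ᵀ ] − (p + 2) cov(x). -/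
open MeasureTheory ProbabilityTheory Matrix

/-- The componentwise mean (expectation) vector of a random vector `x`. -/
noncomputable def meanVec {Ω : Type*} [MeasurableSpace Ω] (Pr : Measure Ω)
    {p : ℕ} (x : Ω → Fin p → ℝ) : Fin p → ℝ :=
  fun j => ∫ ω, x ω j ∂Pr

/-- The covariance matrix `cov(x) = E[(x - E x)(x - E x)ᵀ]` of a random vector. -/
noncomputable def covMatrix {Ω : Type*} [MeasurableSpace Ω] (Pr : Measure Ω)
    {p : ℕ} (x : Ω → Fin p → ℝ) : Matrix (Fin p) (Fin p) ℝ :=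
  Matrix.of fun j k =>
    ∫ ω, (x ω j - meanVec Pr x j) * (x ω k - meanVec Pr x k) ∂Pr

/-- The Mahalanobis distance `r(ω) = √((x-Ex)ᵀ cov(x)⁻¹ (x-Ex))` of `x ω`. -/
noncomputable def mahalanobis {Ω : Type*} [MeasurableSpace Ω] (Pr : Measure Ω)
    {p : ℕ} (x : Ω → Fin p → ℝ) (ω : Ω) : ℝ :=
  Real.sqrt (dotProduct (fun j => x ω j - meanVec Pr x j)
    ((covMatrix Pr x)⁻¹.mulVec (fun j => x ω j - meanVec Pr x j)))

/-- The weighted covariance matrix `wcov_α(x) = E[r^α (x - Ex)(x - Ex)ᵀ]`,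
where `r` is the Mahalanobis distance of `x` (the case `α = 2` is the kurtosis
matrix). -/
noncomputable def wcov {Ω : Type*} [MeasurableSpace Ω] (Pr : Measure Ω)
    (α : ℝ) {p : ℕ} (x : Ω → Fin p → ℝ) : Matrix (Fin p) (Fin p) ℝ :=
  Matrix.of fun j k =>
    ∫ ω, mahalanobis Pr x ω ^ α *
      ((x ω j - meanVec Pr x j) * (x ω k - meanVec Pr x k)) ∂Pr

/-- `f` is integrable with integral `c`. -/
def HasInt {Ω : Type*} [MeasurableSpace Ω] (Pr : Measure Ω) (f : Ω → ℝ) (c : ℝ) : Prop :=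
  Integrable f Pr ∧ ∫ ω, f ω ∂Pr = c

lemma HasInt.add {Ω : Type*} [MeasurableSpace Ω] {Pr : Measure Ω} {f g : Ω → ℝ} {c d : ℝ}
    (hf : HasInt Pr f c) (hg : HasInt Pr g d) : HasInt Pr (fun ω => f ω + g ω) (c + d) :=
  ⟨hf.1.add hg.1, by rw [integral_add hf.1 hg.1, hf.2, hg.2]⟩

lemma HasInt.sub {Ω : Type*} [MeasurableSpace Ω] {Pr : Measure Ω} {f g : Ω → ℝ} {c d : ℝ}
    (hf : HasInt Pr f c) (hg : HasInt Pr g d) : HasInt Pr (fun ω => f ω - g ω) (c - d) :=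
  ⟨hf.1.sub hg.1, by rw [integral_sub hf.1 hg.1, hf.2, hg.2]⟩

lemma HasInt.const_mul {Ω : Type*} [MeasurableSpace Ω] {Pr : Measure Ω} {f : Ω → ℝ} {c : ℝ}
    (r : ℝ) (hf : HasInt Pr f c) : HasInt Pr (fun ω => r * f ω) (r * c) :=
  ⟨hf.1.const_mul r, by rw [integral_const_mul, hf.2]⟩

lemma HasInt.sum {Ω ι : Type*} [Fintype ι] [MeasurableSpace Ω] {Pr : Measure Ω}
    {f : ι → Ω → ℝ} {c : ι → ℝ}
    (hf : ∀ i, HasInt Pr (f i) (c i)) : HasInt Pr (fun ω => ∑ i, f i ω) (∑ i, c i) :=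
  ⟨integrable_finsetSum _ fun i _ => (hf i).1, by
    rw [integral_finsetSum _ fun i _ => (hf i).1]
    exact Finset.sum_congr rfl fun i _ => (hf i).2⟩

lemma HasInt.congr {Ω : Type*} [MeasurableSpace Ω] {Pr : Measure Ω} {f g : Ω → ℝ} {c d : ℝ}
    (hf : HasInt Pr f c) (h : ∀ ω, g ω = f ω) (hc : d = c) : HasInt Pr g d := by
  have : g = f := funext h
  rw [this, hc]; exact hf

lemma abs_mul_four_le (a b c d : ℝ) : |a * b * c * d| ≤ a ^ 4 + b ^ 4 + c ^ 4 + d ^ 4 := by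
  rw [abs_le]
  constructor <;>
  nlinarith [sq_nonneg (a*b+c*d), sq_nonneg (a*b-c*d), sq_nonneg (a^2-b^2),
    sq_nonneg (c^2-d^2), sq_nonneg (a^2), sq_nonneg (b^2), sq_nonneg (c^2), sq_nonneg (d^2)]

lemma integrable_mul_four {Ω : Type*} [MeasurableSpace Ω] {Pr : Measure Ω} {a b c d : Ω → ℝ}
    (ha : Measurable a) (hb : Measurable b) (hc : Measurable c) (hd : Measurable d)
    (ia : Integrable (fun ω => a ω ^ 4) Pr) (ib : Integrable (fun ω => b ω ^ 4) Pr)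
    (ic : Integrable (fun ω => c ω ^ 4) Pr) (id : Integrable (fun ω => d ω ^ 4) Pr) :
    Integrable (fun ω => a ω * b ω * c ω * d ω) Pr := by
  refine Integrable.mono' (((ia.add ib).add ic).add id) ?_ ?_
  · exact (((ha.mul hb).mul hc).mul hd).aestronglyMeasurable
  · exact Filter.Eventually.of_forall fun ω => abs_mul_four_le _ _ _ _

lemma sub_pow_four_le (a m : ℝ) : (a - m) ^ 4 ≤ 8 * a ^ 4 + 8 * m ^ 4 := by
  nlinarith [sq_nonneg (a^2-m^2), sq_nonneg (a+m), sq_nonneg (a-m), sq_nonneg ((a+m)^2),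
    sq_nonneg (a*m), mul_nonneg (sq_nonneg (a+m)) (sq_nonneg (a-m)),
    mul_nonneg (sq_nonneg (a+m)) (sq_nonneg a), mul_nonneg (sq_nonneg (a+m)) (sq_nonneg m)]

/-- The fourth order moment identity for the difference of independent centred copies. -/
lemma fourth_moment {p : ℕ}
    {Ω : Type*} [MeasurableSpace Ω] (Pr : Measure Ω) [IsProbabilityMeasure Pr]
    (x w v : Ω → Fin p → ℝ)
    (hx : Measurable x) (hw : Measurable w) (hv : Measurable v)
    (hmom : ∀ j, Integrable (fun ω => (x ω j) ^ 4) Pr)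
    (hwv : IndepFun w v Pr)
    (hwx : Pr.map w = Pr.map x) (hvx : Pr.map v = Pr.map x) (y : Ω → Fin p → ℝ)
    (hy : ∀ ω j, y ω j = x ω j - meanVec Pr x j) :
    (∀ i l j k, Integrable (fun ω => y ω i * y ω l * y ω j * y ω k) Pr) ∧
    (∀ j k, Integrable (fun ω => y ω j * y ω k) Pr) ∧
    ∀ i l j k, HasInt Pr (fun ω => (w ω i - v ω i) * (w ω l - v ω l) *
        (w ω j - v ω j) * (w ω k - v ω k))
      (2 * (∫ ω, y ω i * y ω l * y ω j * y ω k ∂Pr) +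
        2 * (covMatrix Pr x i l * covMatrix Pr x j k + covMatrix Pr x i j * covMatrix Pr x l k +
          covMatrix Pr x i k * covMatrix Pr x l j)) := by
  obtain ⟨m, hm⟩ : ∃ m, m = meanVec Pr x := ⟨_, rfl⟩
  have hxi : ∀ j, Measurable (fun ω => x ω j) := fun j => (measurable_pi_apply j).comp hx
  have hyi : ∀ j, Measurable (fun ω => y ω j) := fun j => by
    simp only [hy]; exact (hxi j).sub_const _
  have hy4 : ∀ j, Integrable (fun ω => y ω j ^ 4) Pr := fun j => by
    refine Integrable.mono' (((hmom j).const_mul 8).add (integrable_const (8 * m j ^ 4)))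
      ((hyi j).pow_const 4).aestronglyMeasurable (Filter.Eventually.of_forall fun ω => ?_)
    rw [Real.norm_of_nonneg (by positivity), hy, ← hm]
    exact sub_pow_four_le _ _
  have h1m : Measurable (fun _ : Ω => (1:ℝ)) := measurable_const
  have h1 : Integrable (fun _ : Ω => (1:ℝ) ^ 4) Pr := integrable_const _
  have I4 : ∀ i l j k, Integrable (fun ω => y ω i * y ω l * y ω j * y ω k) Pr := fun i l j k =>
    integrable_mul_four (hyi _) (hyi _) (hyi _) (hyi _) (hy4 _) (hy4 _) (hy4 _) (hy4 _)
  have I3 : ∀ i l j, Integrable (fun ω => y ω i * y ω l * y ω j) Pr := fun i l j => by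
    simpa using integrable_mul_four (hyi i) (hyi l) (hyi j) h1m (hy4 _) (hy4 _) (hy4 _) h1
  have I2 : ∀ i l, Integrable (fun ω => y ω i * y ω l) Pr := fun i l => by
    simpa using integrable_mul_four (hyi i) (hyi l) h1m h1m (hy4 _) (hy4 _) h1 h1
  have I1 : ∀ i, Integrable (fun ω => y ω i) Pr := fun i => by
    simpa using integrable_mul_four (hyi i) h1m h1m h1m (hy4 _) h1 h1 h1
  have E1 : ∀ i, ∫ ω, y ω i ∂Pr = 0 := fun i => by
    have hxI : Integrable (fun ω => x ω i) Pr := by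
      simpa using integrable_mul_four (hxi i) h1m h1m h1m (hmom i) h1 h1 h1
    simp only [hy]
    rw [integral_sub hxI (integrable_const _)]
    simp [meanVec]
  have E2 : ∀ i l, ∫ ω, y ω i * y ω l ∂Pr = covMatrix Pr x i l := fun i l => by
    simp only [hy]; rfl
  refine ⟨I4, I2, fun i l j k => ?_⟩
  have T : ∀ u : Ω → Fin p → ℝ, Measurable u → Pr.map u = Pr.map x →
      ∀ F : (Fin p → ℝ) → ℝ, Measurable F → ∀ c, HasInt Pr (fun ω => F (x ω)) c →
      HasInt Pr (fun ω => F (u ω)) c := by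
    intro u hu hux F hF c hc
    have hid : IdentDistrib u x Pr Pr := ⟨hu.aemeasurable, hx.aemeasurable, hux⟩
    have := hid.comp hF
    exact ⟨this.integrable_iff.2 hc.1, by rw [← hc.2]; exact this.integral_eq⟩
  have P : ∀ (F G : (Fin p → ℝ) → ℝ), Measurable F → Measurable G → ∀ c d,
      HasInt Pr (fun ω => F (x ω)) c → HasInt Pr (fun ω => G (x ω)) d →
      HasInt Pr (fun ω => F (w ω) * G (v ω)) (c * d) := by
    intro F G hF hG c d hc hd
    have hc' := T w hw hwx F hF c hc
    have hd' := T v hv hvx G hG d hd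
    have hi := hwv.comp hF hG
    refine ⟨hi.integrable_mul hc'.1 hd'.1, ?_⟩
    rw [← hc'.2, ← hd'.2]
    exact hi.integral_fun_mul_eq_mul_integral hc'.1.aestronglyMeasurable
      hd'.1.aestronglyMeasurable
  obtain ⟨g, hg⟩ : ∃ g : Fin p → (Fin p → ℝ) → ℝ, ∀ i z, g i z = z i - m i :=
    ⟨fun i z => z i - m i, fun _ _ => rfl⟩
  have gm : ∀ i, Measurable (g i) := fun i => by
    have : g i = fun z => z i - m i := funext (hg i)
    rw [this]; exact (measurable_pi_apply i).sub_const _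
  have gx : ∀ i ω, g i (x ω) = y ω i := fun i ω => by rw [hg, hy, hm]
  have G1 : ∀ i, HasInt Pr (fun ω => g i (x ω)) 0 := fun i => by
    simp only [gx]; exact ⟨I1 i, E1 i⟩
  have G2 : ∀ i l, HasInt Pr (fun ω => g i (x ω) * g l (x ω)) (covMatrix Pr x i l) :=
    fun i l => by
      simp only [gx]; exact ⟨I2 i l, E2 i l⟩
  have G3 : ∀ i l j, HasInt Pr (fun ω => g i (x ω) * g l (x ω) * g j (x ω))
      (∫ ω, y ω i * y ω l * y ω j ∂Pr) := fun i l j => by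
    simp only [gx]; exact ⟨I3 i l j, rfl⟩
  have G4 : HasInt Pr (fun ω => g i (x ω) * g l (x ω) * g j (x ω) * g k (x ω))
      (∫ ω, y ω i * y ω l * y ω j * y ω k ∂Pr) := by
    simp only [gx]; exact ⟨I4 i l j k, rfl⟩
  have M2 : ∀ i l, Measurable (fun z => g i z * g l z) := fun i l => (gm i).mul (gm l)
  have M3 : ∀ i l j, Measurable (fun z => g i z * g l z * g j z) :=
    fun i l j => (M2 i l).mul (gm j)
  have M4 : Measurable (fun z => g i z * g l z * g j z * g k z) := (M3 i l j).mul (gm k)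
  have Q31 : ∀ i l j k, HasInt Pr
      (fun ω => (g i (w ω) * g l (w ω) * g j (w ω)) * g k (v ω)) _ := fun i l j k =>
    P _ _ (M3 i l j) (gm k) _ _ (G3 i l j) (G1 k)
  have Q13 : ∀ i l j k, HasInt Pr
      (fun ω => g i (w ω) * (g l (v ω) * g j (v ω) * g k (v ω))) _ := fun i l j k =>
    P _ _ (gm i) (M3 l j k) _ _ (G1 i) (G3 l j k)
  have Q22 : ∀ i l j k, HasInt Pr
      (fun ω => (g i (w ω) * g l (w ω)) * (g j (v ω) * g k (v ω))) _ := fun i l j k =>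
    P _ _ (M2 i l) (M2 j k) _ _ (G2 i l) (G2 j k)
  have Qw := T w hw hwx _ M4 _ G4
  have Qv := T v hv hvx _ M4 _ G4
  have sy : ∀ a b, covMatrix Pr x a b = covMatrix Pr x b a := fun a b => by
    rw [← E2, ← E2]; simp only [mul_comm]
  refine ((Qw.add Qv).add (((((((Q22 i l j k).add (Q22 j k i l)).add (Q22 i j l k)).add
    (Q22 l k i j)).add (Q22 i k l j)).add (Q22 l j i k)).sub
    ((((((((Q31 i l j k).add (Q31 i l k j)).add (Q31 i j k l)).add (Q31 l j k i)).add
    (Q13 i l j k)).add (Q13 l i j k)).add (Q13 j i l k)).add (Q13 k i l j)))).congr ?_ ?_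
  · intro ω
    simp only [hg]
    ring
  · ring

theorem stmt14 {p : ℕ}
    {Ω : Type*} [MeasurableSpace Ω] (Pr : Measure Ω) [IsProbabilityMeasure Pr]
    (x w v : Ω → Fin p → ℝ)
    (hx : Measurable x) (hw : Measurable w) (hv : Measurable v)
    (hmom : ∀ j, Integrable (fun ω => (x ω j) ^ 4) Pr)
    (hcov : IsUnit (covMatrix Pr x).det)
    (hwv : IndepFun w v Pr)
    (hwx : Pr.map w = Pr.map x) (hvx : Pr.map v = Pr.map x) :
    (1 / 2 : ℝ) • Matrix.of (fun j k =>
        ∫ ω, dotProduct (w ω - v ω) ((covMatrix Pr x)⁻¹.mulVec (w ω - v ω)) *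
          ((w ω j - v ω j) * (w ω k - v ω k)) ∂Pr)
      = wcov Pr 2 x + ((p : ℝ) + 2) • covMatrix Pr x := by
  have hxi : ∀ j, Measurable (fun ω => x ω j) := fun j => (measurable_pi_apply j).comp hx
  obtain ⟨y, hy⟩ : ∃ y : Ω → Fin p → ℝ, ∀ ω j, y ω j = x ω j - meanVec Pr x j :=
    ⟨fun ω j => x ω j - meanVec Pr x j, fun _ _ => rfl⟩
  obtain ⟨I4, I2, H⟩ := fourth_moment Pr x w v hx hw hv hmom hwv hwx hvx y hy
  have hyf : ∀ ω, (fun j => x ω j - meanVec Pr x j) = y ω := fun ω => by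
    ext j; rw [hy]
  have E2 : ∀ i l, ∫ ω, y ω i * y ω l ∂Pr = covMatrix Pr x i l := fun i l => by
    simp only [hy]; rfl
  have E2' : ∀ i l, HasInt Pr (fun ω => y ω i * y ω l) (covMatrix Pr x i l) := fun i l =>
    ⟨I2 i l, E2 i l⟩
  have W : ∀ j k, wcov Pr 2 x j k = ∫ ω, mahalanobis Pr x ω ^ (2:ℝ) * (y ω j * y ω k) ∂Pr := by
    intro j k; simp only [hy]; rfl
  have Mh : ∀ ω, mahalanobis Pr x ω = Real.sqrt (y ω ⬝ᵥ ((covMatrix Pr x)⁻¹ *ᵥ y ω)) := by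
    intro ω; unfold mahalanobis; rw [hyf]
  obtain ⟨S, hS⟩ : ∃ S, S = covMatrix Pr x := ⟨_, rfl⟩
  simp only [← hS] at hcov H E2 E2' Mh ⊢
  have sy : ∀ a b, S a b = S b a := fun a b => by
    rw [← E2, ← E2]; simp only [mul_comm]
  have q : ∀ (z : Fin p → ℝ) (A : Matrix (Fin p) (Fin p) ℝ),
      z ⬝ᵥ (A *ᵥ z) = ∑ i, ∑ l, A i l * (z i * z l) := by
    intro z A
    simp only [dotProduct, mulVec, Finset.mul_sum]
    refine Finset.sum_congr rfl fun i _ => Finset.sum_congr rfl fun l _ => by ring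
  have psd : S.PosSemidef := by
    refine Matrix.PosSemidef.of_dotProduct_mulVec_nonneg ?_ ?_
    · ext a b; simp [sy a b]
    · intro z
      have h := HasInt.sum fun i => HasInt.sum fun l => (E2' i l).const_mul (z i * z l)
      have e : star z ⬝ᵥ (S *ᵥ z) = ∑ i, ∑ l, z i * z l * S i l := by
        rw [star_trivial, q]
        refine Finset.sum_congr rfl fun i _ => Finset.sum_congr rfl fun l _ => by ring
      rw [e, ← h.2]
      refine integral_nonneg fun ω => ?_
      have : ∑ i, ∑ l, z i * z l * (y ω i * y ω l) = (∑ i, z i * y ω i) ^ 2 := by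
        rw [sq, Finset.sum_mul_sum]
        refine Finset.sum_congr rfl fun i _ => Finset.sum_congr rfl fun l _ => by ring
      simp only [this]
      positivity
  have psdi := psd.inv
  have W2 : ∀ j k, HasInt Pr (fun ω => (y ω ⬝ᵥ (S⁻¹ *ᵥ y ω)) * (y ω j * y ω k))
      (∑ i, ∑ l, S⁻¹ i l * ∫ ω, y ω i * y ω l * y ω j * y ω k ∂Pr) := by
    intro j k
    refine (HasInt.sum fun i => HasInt.sum fun l =>
      HasInt.const_mul (S⁻¹ i l) ⟨I4 i l j k, rfl⟩).congr (fun ω => ?_) rfl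
    rw [q, Finset.sum_mul]
    refine Finset.sum_congr rfl fun i _ => ?_
    rw [Finset.sum_mul]
    refine Finset.sum_congr rfl fun l _ => by ring
  ext j k
  have L : HasInt Pr (fun ω => ((w ω - v ω) ⬝ᵥ (S⁻¹ *ᵥ (w ω - v ω))) *
      ((w ω j - v ω j) * (w ω k - v ω k)))
      (∑ i, ∑ l, S⁻¹ i l * (2 * (∫ ω, y ω i * y ω l * y ω j * y ω k ∂Pr) +
      2 * (S i l * S j k + S i j * S l k + S i k * S l j))) := by
    refine (HasInt.sum fun i => HasInt.sum fun l =>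
      HasInt.const_mul (S⁻¹ i l) (H i l j k)).congr (fun ω => ?_) rfl
    rw [q, Finset.sum_mul]
    refine Finset.sum_congr rfl fun i _ => ?_
    rw [Finset.sum_mul]
    refine Finset.sum_congr rfl fun l _ => by simp only [Pi.sub_apply]; ring
  have hW : wcov Pr 2 x j k = ∑ i, ∑ l, S⁻¹ i l * ∫ ω, y ω i * y ω l * y ω j * y ω k ∂Pr := by
    rw [W, ← (W2 j k).2]
    congr 1; ext ω
    rw [Mh, Real.rpow_two, Real.sq_sqrt]
    simpa using psdi.dotProduct_mulVec_nonneg (y ω)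
  have t1 : ∑ i, ∑ l, S⁻¹ i l * S i l = p := by
    have : (S⁻¹ * S).trace = p := by rw [Matrix.nonsing_inv_mul _ hcov]; simp
    rw [← this]
    simp only [Matrix.trace, Matrix.diag, Matrix.mul_apply]
    refine Finset.sum_congr rfl fun i _ => Finset.sum_congr rfl fun l _ => by rw [sy]
  have t2 : ∀ j k, ∑ i, ∑ l, S⁻¹ i l * (S i j * S l k) = S j k := by
    intro j k
    have : (S * (S⁻¹ * S)) j k = S j k := by rw [Matrix.nonsing_inv_mul _ hcov, mul_one]
    rw [← this]
    simp only [Matrix.mul_apply, Finset.mul_sum]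
    refine Finset.sum_congr rfl fun i _ => Finset.sum_congr rfl fun l _ => by
      rw [sy j i]; ring
  simp only [Matrix.smul_apply, Matrix.add_apply, Matrix.of_apply, smul_eq_mul]
  rw [L.2, hW]
  have t3 := t2 k j
  rw [sy k j] at t3
  have key : ∑ i, ∑ l, S⁻¹ i l * (2 * (∫ ω, y ω i * y ω l * y ω j * y ω k ∂Pr) +
      2 * (S i l * S j k + S i j * S l k + S i k * S l j)) =
      2 * (∑ i, ∑ l, S⁻¹ i l * ∫ ω, y ω i * y ω l * y ω j * y ω k ∂Pr) +
      2 * ((∑ i, ∑ l, S⁻¹ i l * S i l) * S j k + (∑ i, ∑ l, S⁻¹ i l * (S i j * S l k)) +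
        ∑ i, ∑ l, S⁻¹ i l * (S i k * S l j)) := by
    simp only [Finset.mul_sum, Finset.sum_mul, ← Finset.sum_add_distrib]
    refine Finset.sum_congr rfl fun i _ => Finset.sum_congr rfl fun l _ => by ring
  rw [key, t1, t2, t3]
  ring
end
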